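/- arXiv:2505.02058 — 2 statements merged into one kernel-verified Lean document; each statement's English description precedes it below -/
import Mathlib

section
/- For every integer n ≥ 3 and all integers i, j with 1 ≤ i < j ≤ n, the number of derangements of {1,…,n} in which i precedes j satisfies 2(n−2)·#{σ ∈ D_n : σ⁻¹(i) < σ⁻¹(j)} = (n−2)²·d_{n−2} + d_{n−1}·(n² − 3n + 2i − 2j + 4). -/
/-- Number of inversions of a permutation of `Fin n`: the number of pairs of
positions `a < b` with `σ a > σ b`. -/
def inversions {n : ℕ} (σ : Equiv.Perm (Fin n)) : ℕ :=
  ((Finset.univ : Finset (Fin n × Fin n)).filter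
    (fun p => p.1 < p.2 ∧ σ p.2 < σ p.1)).card

/-- The set of derangements (fixed-point-free permutations) of `Fin n`. -/
def derangeSet (n : ℕ) : Finset (Equiv.Perm (Fin n)) :=
  Finset.univ.filter (fun σ => ∀ x, σ x ≠ x)

/-- The number of derangements of `Fin n` (so `numDerange 0 = 1`). -/
def numDerange (n : ℕ) : ℕ := (derangeSet n).card

/-- The number of fixed points of a permutation of `Fin n`. -/
def fixedPointCount {n : ℕ} (σ : Equiv.Perm (Fin n)) : ℕ :=
  (Finset.univ.filter (fun x => σ x = x)).card

/-- The set of permutations of `Fin n` with exactly `k` fixed points. -/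
def permsWithFixed (n k : ℕ) : Finset (Equiv.Perm (Fin n)) :=
  Finset.univ.filter (fun σ => fixedPointCount σ = k)

/-- The number of permutations of `Fin n` with exactly `k` fixed points. -/
def numPermsWithFixed (n k : ℕ) : ℕ := (permsWithFixed n k).card

section DerangementCounts

open Equiv Finset

variable {α : Type*} [Fintype α] [DecidableEq α]

theorem numDerange_eq_numDerangements (n : ℕ) : numDerange n = numDerangements n := by
  rw [← card_derangements_fin_eq_numDerangements, Fintype.card_subtype]
  unfold numDerange derangeSet
  congr 1
  ext σ
  simp only [mem_filter]
  rfl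

theorem card_filter_derangement :
    #{τ : Perm α | ∀ x, τ x ≠ x} = numDerangements (Fintype.card α) := by
  rw [← card_derangements_eq_numDerangements α, Fintype.card_subtype]
  rfl

/-- Conjugation by `g` preserves derangements. -/
theorem card_filter_derangement_conj (g : Perm α) (P Q : Perm α → Prop) [DecidablePred P]
    [DecidablePred Q] (h : ∀ τ, P τ ↔ Q (g * τ * g⁻¹)) :
    #{τ : Perm α | (∀ x, τ x ≠ x) ∧ P τ} = #{τ : Perm α | (∀ x, τ x ≠ x) ∧ Q τ} := by
  refine card_equiv (MulAut.conj g).toEquiv fun τ => ?_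
  simp only [mem_filter, mem_univ, true_and, MulEquiv.toEquiv_eq_coe, EquivLike.coe_coe,
    MulAut.conj_apply, ← h]
  refine and_congr_left fun _ => ⟨fun hτ x hx => hτ (g⁻¹ x) ?_, fun hτ x hx => hτ (g x) ?_⟩
  · rw [Perm.eq_inv_iff_eq]
    simpa using hx
  · simpa using hx

/-- Derangements exchanging `i` and `j` are derangements of the other points. -/
theorem card_filter_derangement_exchange {i j : α} (hij : i ≠ j) :
    #{τ : Perm α | (∀ x, τ x ≠ x) ∧ τ i = j ∧ τ j = i} =
      numDerangements (Fintype.card α - 2) := by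
  have hcard : Fintype.card {a : α // ¬ (a = i ∨ a = j)} = Fintype.card α - 2 := by
    rw [Fintype.card_subtype_compl, Fintype.card_subtype]
    congr 1
    rw [← card_pair hij]
    congr 1
    ext
    simp
  rw [← hcard, ← card_derangements_eq_numDerangements,
    Fintype.card_congr (derangements.subtypeEquiv fun a : α => ¬ (a = i ∨ a = j)),
    Fintype.card_subtype]
  refine card_equiv (Equiv.mulLeft (swap i j)) fun τ => ?_
  simp only [mem_filter, mem_univ, true_and, Equiv.coe_mulLeft, not_not,
    Function.mem_fixedPoints_iff, Perm.mul_apply, swap_apply_def]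
  constructor
  · rintro ⟨h, hi, hj⟩ a
    have h1 := h a
    have h2 : τ a = i → a = j := fun e => τ.injective (e.trans hj.symm)
    have h3 : τ a = j → a = i := fun e => τ.injective (e.trans hi.symm)
    grind
  · intro h
    have hi := (h i).1 (Or.inl rfl)
    have hj := (h j).1 (Or.inr rfl)
    refine ⟨fun x hx => ?_, by grind, by grind⟩
    have := h x
    grind

theorem card_filter_derangement_apply_eq {i j : α} (hij : i ≠ j) :
    #{τ : Perm α | (∀ x, τ x ≠ x) ∧ τ i = j} =
      numDerangements (Fintype.card α - 1) + numDerangements (Fintype.card α - 2) := by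
  have hconst : ∀ b ∈ univ.erase i, #{τ : Perm α | (∀ x, τ x ≠ x) ∧ τ i = b} =
      #{τ : Perm α | (∀ x, τ x ≠ x) ∧ τ i = j} := by
    intro b hb
    refine card_filter_derangement_conj (swap b j) _ _ fun τ => ?_
    rw [Perm.mul_apply, Perm.mul_apply, swap_inv,
      swap_apply_of_ne_of_ne (ne_of_mem_erase hb).symm hij, swap_apply_eq_iff, swap_apply_right]
  have hmaps : Set.MapsTo (fun τ : Perm α => τ i)
      ({τ : Perm α | ∀ x, τ x ≠ x} : Finset (Perm α)) (univ.erase i : Finset α) := by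
    intro τ hτ
    simp only [coe_filter, mem_univ, true_and, Set.mem_ofPred_eq] at hτ
    simpa using hτ i
  have hsum := card_eq_sum_card_fiberwise hmaps
  simp only [filter_filter] at hsum
  rw [sum_congr rfl hconst, sum_const, smul_eq_mul, card_erase_of_mem (mem_univ i), card_univ,
    card_filter_derangement] at hsum
  have h2 : 2 ≤ Fintype.card α := by
    rw [← card_pair hij]
    exact card_le_univ _
  obtain ⟨m, hm⟩ := Nat.exists_eq_add_of_le' h2
  rw [hm, numDerangements_add_two] at hsum
  rw [hm]
  refine Nat.eq_of_mul_eq_mul_left (Nat.succ_pos m) ?_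
  simp only [Nat.add_sub_cancel, show m + 2 - 1 = m + 1 by omega] at hsum ⊢
  rw [Nat.succ_eq_add_one, ← hsum, Nat.add_comm (numDerangements m)]

/-- Each of the `card α - 2` possible values `b` of `τ j` occurs equally often among the
derangements with `τ i = j` and `τ j ≠ i`. -/
theorem card_filter_derangement_apply_eq_apply_eq {i j b : α} (hij : i ≠ j) (hbi : b ≠ i)
    (hbj : b ≠ j) :
    (Fintype.card α - 2) * #{τ : Perm α | (∀ x, τ x ≠ x) ∧ τ i = j ∧ τ j = b} =
      numDerangements (Fintype.card α - 1) := by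
  have hconst : ∀ c ∈ (univ.erase j).erase i,
      #{τ : Perm α | (∀ x, τ x ≠ x) ∧ τ i = j ∧ τ j = c} =
        #{τ : Perm α | (∀ x, τ x ≠ x) ∧ τ i = j ∧ τ j = b} := by
    intro c hc
    simp only [mem_erase, mem_univ, and_true] at hc
    have hsi : swap c b i = i := swap_apply_of_ne_of_ne hc.1.symm hbi.symm
    have hsj : swap c b j = j := swap_apply_of_ne_of_ne hc.2.symm hbj.symm
    refine card_filter_derangement_conj (swap c b) _ _ fun τ => ?_
    simp only [Perm.mul_apply, swap_inv, hsi, hsj]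
    rw [swap_apply_eq_iff, swap_apply_eq_iff, hsj, swap_apply_right]
  have hmaps : Set.MapsTo (fun τ : Perm α => τ j)
      ({τ : Perm α | (∀ x, τ x ≠ x) ∧ τ i = j} : Finset (Perm α))
      (univ.erase j : Finset α) := by
    intro τ hτ
    simp only [coe_filter, mem_univ, true_and, Set.mem_ofPred_eq] at hτ
    simpa using hτ.1 j
  have hsum := card_eq_sum_card_fiberwise hmaps
  have hmem : i ∈ univ.erase j := by simpa using hij
  simp only [filter_filter, and_assoc] at hsum
  rw [← add_sum_erase _ _ hmem, sum_congr rfl hconst, sum_const, smul_eq_mul,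
    card_erase_of_mem hmem, card_erase_of_mem (mem_univ j), card_univ,
    card_filter_derangement_apply_eq hij, card_filter_derangement_exchange hij,
    Nat.sub_sub, one_add_one_eq_two] at hsum
  omega

/-- Derangements with `τ i = j` and `τ j` in a prescribed set avoiding `i` and `j`. -/
theorem card_filter_derangement_apply_eq_apply_mem {i j : α} (hij : i ≠ j) (B : Finset α)
    (hi : i ∉ B) (hj : j ∉ B) :
    (Fintype.card α - 2) * #{τ : Perm α | (∀ x, τ x ≠ x) ∧ τ i = j ∧ τ j ∈ B} =
      #B * numDerangements (Fintype.card α - 1) := by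
  have hmaps : Set.MapsTo (fun τ : Perm α => τ j)
      ({τ : Perm α | (∀ x, τ x ≠ x) ∧ τ i = j ∧ τ j ∈ B} : Finset (Perm α)) B := by
    intro τ hτ
    simp only [coe_filter, mem_univ, true_and, Set.mem_ofPred_eq] at hτ
    exact hτ.2.2
  rw [card_eq_sum_card_fiberwise hmaps, mul_sum, ← smul_eq_mul (#B), ← sum_const]
  refine sum_congr rfl fun b hb => ?_
  rw [← card_filter_derangement_apply_eq_apply_eq hij (ne_of_mem_of_not_mem hb hi)
    (ne_of_mem_of_not_mem hb hj), filter_filter]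
  congr 2
  ext τ
  simp only [mem_filter, mem_univ, true_and]
  grind

/-- Composition with `swap i j` pairs off the derangements with `τ i ≠ j` and `τ j ≠ i`
according to the relative order of `τ i` and `τ j`. -/
theorem two_mul_card_filter_derangement_lt {α : Type*} [Fintype α] [LinearOrder α]
    {i j : α} (hij : i ≠ j) :
    2 * #{τ : Perm α | (∀ x, τ x ≠ x) ∧ (τ i ≠ j ∧ τ j ≠ i) ∧ τ i < τ j} =
      #{τ : Perm α | (∀ x, τ x ≠ x) ∧ τ i ≠ j ∧ τ j ≠ i} := by
  have hrev : #{τ : Perm α | (∀ x, τ x ≠ x) ∧ (τ i ≠ j ∧ τ j ≠ i) ∧ τ i < τ j} =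
      #{τ : Perm α | (∀ x, τ x ≠ x) ∧ (τ i ≠ j ∧ τ j ≠ i) ∧ ¬ τ i < τ j} := by
    refine card_equiv (Equiv.mulRight (swap i j)) fun τ => ?_
    simp only [mem_filter, mem_univ, true_and, Equiv.coe_mulRight, Perm.mul_apply,
      swap_apply_left, swap_apply_right, not_lt]
    have hne : τ i ≠ τ j := τ.injective.ne hij
    constructor
    · rintro ⟨h, ⟨h1, h2⟩, h3⟩
      refine ⟨fun x => ?_, ⟨h j, h i⟩, h3.le⟩
      have := h x
      rw [swap_apply_def]
      grind
    · rintro ⟨h, ⟨h1, h2⟩, h3⟩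
      have hi := h i
      have hj := h j
      rw [swap_apply_left] at hi
      rw [swap_apply_right] at hj
      refine ⟨fun x => ?_, ⟨hj, hi⟩, lt_of_le_of_ne h3 hne⟩
      have := h x
      rw [swap_apply_def] at this
      grind
  have hsplit := card_filter_add_card_filter_not
    (s := ({τ : Perm α | (∀ x, τ x ≠ x) ∧ τ i ≠ j ∧ τ j ≠ i} : Finset (Perm α)))
    (fun τ => τ i < τ j)
  simp only [filter_filter, and_assoc] at hsplit hrev ⊢
  omega

/-- Classification of the derangements satisfying `P` by whether `τ i = j` and `τ j = i`. -/
theorem card_filter_derangement_split (i j : α) (P : Perm α → Prop) [DecidablePred P] :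
    #{τ : Perm α | (∀ x, τ x ≠ x) ∧ P τ} +
        #{τ : Perm α | (∀ x, τ x ≠ x) ∧ (τ i = j ∧ τ j = i) ∧ P τ} =
      #{τ : Perm α | (∀ x, τ x ≠ x) ∧ τ i = j ∧ P τ} +
        #{τ : Perm α | (∀ x, τ x ≠ x) ∧ τ j = i ∧ P τ} +
        #{τ : Perm α | (∀ x, τ x ≠ x) ∧ (τ i ≠ j ∧ τ j ≠ i) ∧ P τ} := by
  simp only [card_filter, ← sum_add_distrib]
  refine sum_congr rfl fun τ _ => ?_
  by_cases h0 : ∀ x, τ x ≠ x <;> by_cases h1 : τ i = j <;> by_cases h2 : τ j = i <;>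
    by_cases h3 : P τ <;> simp [h0, h1, h2, h3]

/-- The count of derangements with `τ i < τ j`. -/
theorem two_mul_card_filter_derangement_apply_lt {α : Type*} [Fintype α] [LinearOrder α]
    [LocallyFiniteOrderTop α] [LocallyFiniteOrderBot α] {i j : α} (hij : i < j) :
    (Fintype.card α - 2) * (2 * #{τ : Perm α | (∀ x, τ x ≠ x) ∧ τ i < τ j} +
        2 * numDerangements (Fintype.card α - 1) + numDerangements (Fintype.card α - 2)) =
      (Fintype.card α - 2) * numDerangements (Fintype.card α) +
        2 * (#(Ioi j) + #(Iio i)) * numDerangements (Fintype.card α - 1) := by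
  have hlt := card_filter_derangement_split i j (fun τ => τ i < τ j)
  have hall := card_filter_derangement_split i j (fun _ => True)
  have hhalf := two_mul_card_filter_derangement_lt hij.ne
  have hupper := card_filter_derangement_apply_eq_apply_mem hij.ne (Ioi j) (by simp [hij.le])
    (by simp)
  have hlower := card_filter_derangement_apply_eq_apply_mem hij.ne' (Iio i) (by simp [hij.le])
    (by simp)
  have hexch : #{τ : Perm α | (∀ x, τ x ≠ x) ∧ (τ i = j ∧ τ j = i) ∧ τ i < τ j} = 0 := by
    rw [card_eq_zero, filter_eq_empty_iff]
    rintro τ - ⟨-, ⟨h1, h2⟩, h3⟩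
    rw [h1, h2] at h3
    exact lt_asymm hij h3
  have hup : #{τ : Perm α | (∀ x, τ x ≠ x) ∧ τ i = j ∧ τ i < τ j} =
      #{τ : Perm α | (∀ x, τ x ≠ x) ∧ τ i = j ∧ τ j ∈ Ioi j} := by
    congr 1
    ext τ
    simp only [mem_filter, mem_univ, true_and, mem_Ioi]
    grind
  have hlow : #{τ : Perm α | (∀ x, τ x ≠ x) ∧ τ j = i ∧ τ i < τ j} =
      #{τ : Perm α | (∀ x, τ x ≠ x) ∧ τ j = i ∧ τ i ∈ Iio i} := by
    congr 1
    ext τ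
    simp only [mem_filter, mem_univ, true_and, mem_Iio]
    grind
  simp only [and_true, card_filter_derangement, card_filter_derangement_exchange hij.ne,
    card_filter_derangement_apply_eq hij.ne, card_filter_derangement_apply_eq hij.ne'] at hall
  rw [hexch, hup, hlow] at hlt
  zify at *
  linear_combination 2 * (Fintype.card α - 2 : ℕ) * hlt + 2 * hupper + 2 * hlower +
    (Fintype.card α - 2 : ℕ) * hhalf -
    (Fintype.card α - 2 : ℕ) * hall

end DerangementCounts

/-- The number of derangements of `{1,…,n}` in which `i` precedes `j` satisfies
`2(n-2) · # = (n-2)² · d_{n-2} + d_{n-1} · (n² - 3n + 2i - 2j + 4)`. -/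
theorem stmt15 (n i j : ℕ) (hn : 3 ≤ n) (hi : 1 ≤ i) (hij : i < j) (hj : j ≤ n) :
    2 * ((n : ℤ) - 2) * (((derangeSet n).filter
        (fun σ => σ⁻¹ (⟨i - 1, by omega⟩ : Fin n) < σ⁻¹ (⟨j - 1, by omega⟩ : Fin n))).card : ℤ) =
      ((n : ℤ) - 2) ^ 2 * (numDerange (n - 2) : ℤ) +
        (numDerange (n - 1) : ℤ) * ((n : ℤ) ^ 2 - 3 * (n : ℤ) + 2 * (i : ℤ) - 2 * (j : ℤ) + 4) := by
  set a : Fin n := ⟨i - 1, by omega⟩ with ha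
  set b : Fin n := ⟨j - 1, by omega⟩ with hb
  have hab : a < b := by
    rw [Fin.lt_def, ha, hb]
    dsimp only
    omega
  have hinv : ((derangeSet n).filter (fun σ => σ⁻¹ a < σ⁻¹ b)).card =
      (Finset.univ.filter
        (fun τ : Equiv.Perm (Fin n) => (∀ x, τ x ≠ x) ∧ τ a < τ b)).card := by
    refine Finset.card_equiv (Equiv.inv _) fun σ => ?_
    simp only [derangeSet, Finset.mem_filter, Finset.mem_univ, true_and, Equiv.inv_apply]
    refine and_congr_left fun _ => forall_congr' fun x => not_congr ?_
    rw [Equiv.Perm.inv_eq_iff_eq, eq_comm]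
  have hcount := two_mul_card_filter_derangement_apply_lt hab
  rw [Fintype.card_fin, Fin.card_Ioi, Fin.card_Iio] at hcount
  rw [hinv, numDerange_eq_numDerangements, numDerange_eq_numDerangements]
  generalize hc : (Finset.univ.filter
    (fun τ : Equiv.Perm (Fin n) => (∀ x, τ x ≠ x) ∧ τ a < τ b)).card = c
  replace hcount : (n - 2) * (2 * c + 2 * numDerangements (n - 1) + numDerangements (n - 2)) =
      (n - 2) * numDerangements n + 2 * (n - 1 - b + a) * numDerangements (n - 1) := by
    rw [← hc]
    convert hcount
  have hval : n - 1 - (b : ℕ) + a = n - 1 + i - j := by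
    rw [ha, hb]
    dsimp only
    omega
  rw [hval] at hcount
  obtain ⟨m, rfl⟩ : ∃ m, n = m + 2 := ⟨n - 2, by omega⟩
  rw [numDerangements_add_two] at hcount
  simp only [Nat.add_sub_cancel, show m + 2 - 1 = m + 1 by omega] at hcount ⊢
  zify [show j ≤ m + 1 + i by omega] at hcount
  push_cast
  linear_combination hcount
end

section
/- Let n ≥ 3, let 1 ≤ i < j ≤ n, and let 1 ≤ k ≤ n. Then the number of permutations of {1,…,n} with exactly k fixed points in which j is a fixed point and i precedes j satisfies (n−1)(n−2)·#{σ ∈ D_{n,k} : σ(j) = j and σ⁻¹(i) < j} = d_{n−1,k−1}·((k−1)(n−2) + (n−k)(j−2)). -/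
theorem fixedPointCount_add_card_support {n : ℕ} (σ : Equiv.Perm (Fin n)) :
    fixedPointCount σ + σ.support.card = n := by
  have h := Finset.card_filter_add_card_filter_not (s := (Finset.univ : Finset (Fin n)))
    (fun x => σ x = x)
  simpa [fixedPointCount, Equiv.Perm.support] using h

theorem fixedPointCount_conj {n : ℕ} (τ σ : Equiv.Perm (Fin n)) :
    fixedPointCount (τ * σ * τ⁻¹) = fixedPointCount σ := by
  have h₁ := fixedPointCount_add_card_support (τ * σ * τ⁻¹)
  have h₂ := fixedPointCount_add_card_support σ
  rw [Equiv.Perm.card_support_conj] at h₁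
  omega

/-- The permutations with exactly `k` fixed points, one of which is `j`. -/
def permsWithFixedAt (n k : ℕ) (j : Fin n) : Finset (Equiv.Perm (Fin n)) :=
  (permsWithFixed n k).filter (fun σ => σ j = j)

theorem mem_permsWithFixedAt {n k : ℕ} {j : Fin n} {σ : Equiv.Perm (Fin n)} :
    σ ∈ permsWithFixedAt n k j ↔ fixedPointCount σ = k ∧ σ j = j := by
  simp [permsWithFixedAt, permsWithFixed]

/-- Extending a permutation of `Fin m` by the fixed point `j` is a bijection onto the
permutations fixing `j`. -/
theorem card_permsWithFixedAt (m k : ℕ) (j : Fin (m + 1)) :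
    (permsWithFixedAt (m + 1) (k + 1) j).card = numPermsWithFixed m k := by
  let f : Fin m ≃ {x // x ≠ j} := finSuccAboveEquiv j
  have hcount (τ : Equiv.Perm (Fin m)) :
      fixedPointCount (τ.extendDomain f) = fixedPointCount τ + 1 := by
    have h₁ := fixedPointCount_add_card_support (τ.extendDomain f)
    have h₂ := fixedPointCount_add_card_support τ
    rw [Equiv.Perm.card_support_extend_domain] at h₁
    omega
  symm
  refine Finset.card_bij (fun τ _ => τ.extendDomain f) ?_ ?_ ?_
  · intro τ hτ
    rw [mem_permsWithFixedAt, hcount]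
    refine ⟨?_, Equiv.Perm.extendDomain_apply_not_subtype _ _ (by simp)⟩
    simpa [permsWithFixed] using hτ
  · intro τ _ τ' _ h
    exact Equiv.Perm.extendDomainHom_injective f h
  · intro σ hσ
    obtain ⟨hk, hj⟩ := mem_permsWithFixedAt.1 hσ
    have hne (x : Fin (m + 1)) : σ x ≠ j ↔ x ≠ j := by
      conv_lhs => rw [← hj]
      exact σ.injective.ne_iff
    have hext : (f.symm.permCongr (σ.subtypePerm hne)).extendDomain f = σ := by
      ext x
      by_cases hx : x = j
      · rw [Equiv.Perm.extendDomain_apply_not_subtype _ _ (by simp [hx]), hx, hj]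
      · rw [Equiv.Perm.extendDomain_apply_subtype (p := (· ≠ j)) _ _ hx]
        simp [Equiv.permCongr_apply]
    refine ⟨_, ?_, hext⟩
    have h := hcount (f.symm.permCongr (σ.subtypePerm hne))
    rw [hext, hk] at h
    simp only [permsWithFixed, Finset.mem_filter, Finset.mem_univ, true_and]
    omega

/-- Conjugation by a permutation fixing `j` transports the condition `σ p = q`. -/
theorem card_filter_permsWithFixedAt_conj {n k : ℕ} {j : Fin n} (τ : Equiv.Perm (Fin n))
    (hτ : τ j = j) (p q : Fin n) :
    ((permsWithFixedAt n k j).filter (fun σ => σ (τ p) = τ q)).card =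
      ((permsWithFixedAt n k j).filter (fun σ => σ p = q)).card := by
  have hτ' : τ.symm j = j := by rw [Equiv.symm_apply_eq, hτ]
  symm
  refine Finset.card_equiv (MulAut.conj τ).toEquiv fun σ => ?_
  have hj : τ (σ j) = j ↔ σ j = j := by
    conv_lhs => rw [← hτ]
    rw [hτ]
    nth_rewrite 2 [← hτ]
    exact τ.injective.eq_iff
  simp [mem_permsWithFixedAt, fixedPointCount_conj, hτ', hj]

/-- Double counting of the fixed points other than `j`. -/
theorem mul_card_filter_fixed {n k : ℕ} {i j : Fin n} (hij : i ≠ j) :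
    (n - 1) * ((permsWithFixedAt n k j).filter (fun σ => σ i = i)).card =
      (k - 1) * (permsWithFixedAt n k j).card := by
  have h := Finset.sum_card_bipartiteAbove_eq_sum_card_bipartiteBelow
    (s := (Finset.univ.erase j : Finset (Fin n))) (t := permsWithFixedAt n k j)
    (fun x σ => σ x = x)
  rw [Finset.sum_const_nat (m := ((permsWithFixedAt n k j).filter (fun σ => σ i = i)).card),
    Finset.sum_const_nat (m := k - 1)] at h
  · simpa [Finset.card_erase_of_mem, mul_comm] using h
  · intro σ hσ
    obtain ⟨hk, hj⟩ := mem_permsWithFixedAt.1 hσ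
    rw [Finset.bipartiteBelow, Finset.filter_erase, Finset.card_erase_of_mem (by simp [hj]), ← hk]
    rfl
  · intro x hx
    have hxj : x ≠ j := Finset.ne_of_mem_erase hx
    have h := card_filter_permsWithFixedAt_conj (k := k) (Equiv.swap i x)
      (Equiv.swap_apply_of_ne_of_ne hij.symm hxj.symm) i i
    simpa [Finset.bipartiteAbove] using h

/-- The number of permutations fixing `j` that send a point of `P` to `i`, in terms of the
number of those fixing `i` and the number of those sending a given other point to `i`. -/
theorem card_filter_inv_mem {n k : ℕ} {i j p : Fin n} (hpi : p ≠ i) (hpj : p ≠ j)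
    (P : Finset (Fin n)) (hi : i ∈ P) (hj : j ∉ P) :
    ((permsWithFixedAt n k j).filter (fun σ => σ⁻¹ i ∈ P)).card =
      ((permsWithFixedAt n k j).filter (fun σ => σ i = i)).card +
        (P.card - 1) * ((permsWithFixedAt n k j).filter (fun σ => σ p = i)).card := by
  have hij : i ≠ j := fun h => hj (h ▸ hi)
  rw [Finset.card_eq_sum_card_fiberwise (f := fun σ : Equiv.Perm (Fin n) => σ⁻¹ i) (t := P)
    (by intro σ hσ; exact (Finset.mem_filter.1 hσ).2)]
  have hfib (x : Fin n) (hx : x ∈ P) :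
      (((permsWithFixedAt n k j).filter (fun σ => σ⁻¹ i ∈ P)).filter (fun σ => σ⁻¹ i = x)) =
        (permsWithFixedAt n k j).filter (fun σ => σ x = i) := by
    ext σ
    simp only [Finset.mem_filter, Equiv.Perm.inv_eq_iff_eq]
    constructor
    · rintro ⟨⟨h₁, -⟩, h₂⟩
      exact ⟨h₁, h₂.symm⟩
    · rintro ⟨h₁, h₂⟩
      exact ⟨⟨h₁, by simpa [← h₂] using hx⟩, h₂.symm⟩
  rw [Finset.sum_congr rfl fun x hx => congrArg Finset.card (hfib x hx),
    ← Finset.add_sum_erase _ _ hi, Finset.sum_const_nat, Finset.card_erase_of_mem hi]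
  intro x hx
  obtain ⟨hxi, hxP⟩ := Finset.mem_erase.1 hx
  have hxj : x ≠ j := fun h => hj (h ▸ hxP)
  have h := card_filter_permsWithFixedAt_conj (k := k) (Equiv.swap p x)
    (Equiv.swap_apply_of_ne_of_ne hpj.symm hxj.symm) p i
  rwa [Equiv.swap_apply_left, Equiv.swap_apply_of_ne_of_ne hpi.symm hxi.symm] at h

/-- The number of permutations of `{1,…,n}` with exactly `k` fixed points in which `j`
is a fixed point and `i` precedes `j` satisfies
`(n-1)(n-2) · # = d_{n-1,k-1} · ((k-1)(n-2) + (n-k)(j-2))`. -/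
theorem stmt16 (n k i j : ℕ) (hn : 3 ≤ n) (hk1 : 1 ≤ k) (hk2 : k ≤ n)
    (hi : 1 ≤ i) (hij : i < j) (hj : j ≤ n) :
    ((n : ℤ) - 1) * ((n : ℤ) - 2) * (((permsWithFixed n k).filter
        (fun σ => σ (⟨j - 1, by omega⟩ : Fin n) = (⟨j - 1, by omega⟩ : Fin n) ∧
          ((σ⁻¹ (⟨i - 1, by omega⟩ : Fin n) : Fin n) : ℕ) + 1 < j)).card : ℤ) =
      (numPermsWithFixed (n - 1) (k - 1) : ℤ) *
        (((k : ℤ) - 1) * ((n : ℤ) - 2) + ((n : ℤ) - (k : ℤ)) * ((j : ℤ) - 2)) := by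
  obtain ⟨m, rfl⟩ : ∃ m, n = m + 1 := ⟨n - 1, by omega⟩
  obtain ⟨l, rfl⟩ : ∃ l, k = l + 1 := ⟨k - 1, by omega⟩
  set a : Fin (m + 1) := ⟨i - 1, by omega⟩ with ha
  set b : Fin (m + 1) := ⟨j - 1, by omega⟩ with hb
  have hab : a < b := by
    rw [ha, hb, Fin.mk_lt_mk]
    omega
  obtain ⟨p, hp⟩ : ∃ p, p ∉ ({a, b} : Finset (Fin (m + 1))) := by
    by_contra! h
    have h₁ := Finset.card_le_card (fun x _ => h x : Finset.univ ⊆ ({a, b} : Finset (Fin (m + 1))))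
    have h₂ := Finset.card_le_two (a := a) (b := b)
    rw [Finset.card_univ, Fintype.card_fin] at h₁
    omega
  obtain ⟨hpa, hpb⟩ : p ≠ a ∧ p ≠ b := by simpa using hp
  have hcount : (permsWithFixed (m + 1) (l + 1)).filter
      (fun σ => σ b = b ∧ ((σ⁻¹ a : Fin (m + 1)) : ℕ) + 1 < j) =
      (permsWithFixedAt (m + 1) (l + 1) b).filter (fun σ => σ⁻¹ a ∈ Finset.Iio b) := by
    rw [permsWithFixedAt, Finset.filter_filter]
    refine Finset.filter_congr fun σ _ => and_congr_right fun _ => ?_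
    rw [Finset.mem_Iio, Fin.lt_def]
    change _ ↔ _ < j - 1
    omega
  have hbelow := card_filter_inv_mem (k := l + 1) hpa hpb (Finset.Iio b)
    (Finset.mem_Iio.2 hab) (by simp)
  have htotal := card_filter_inv_mem (k := l + 1) hpa hpb (Finset.univ.erase b)
    (by simp [hab.ne]) (by simp)
  have hall : (permsWithFixedAt (m + 1) (l + 1) b).filter (fun σ => σ⁻¹ a ∈ Finset.univ.erase b) =
      permsWithFixedAt (m + 1) (l + 1) b := by
    refine Finset.filter_true_of_mem fun σ hσ => ?_
    rw [Finset.mem_erase, ne_eq, Equiv.Perm.inv_eq_iff_eq, (mem_permsWithFixedAt.1 hσ).2]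
    exact ⟨hab.ne, Finset.mem_univ _⟩
  have hfix := mul_card_filter_fixed (k := l + 1) hab.ne
  rw [hall, Finset.card_erase_of_mem (Finset.mem_univ _), Finset.card_univ, Fintype.card_fin,
    card_permsWithFixedAt] at htotal
  rw [card_permsWithFixedAt] at hfix
  rw [Fin.card_Iio] at hbelow
  rw [hcount, hbelow]
  simp only [Nat.add_sub_cancel] at htotal hfix ⊢
  obtain ⟨r, rfl⟩ : ∃ r, m = r + 1 := ⟨m - 1, by omega⟩
  obtain ⟨s, rfl⟩ : ∃ s, j = s + 2 := ⟨j - 2, by omega⟩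
  have hs : (b : ℕ) - 1 = s := by simp [hb]
  rw [hs]
  simp only [Nat.add_sub_cancel] at htotal
  zify at htotal hfix
  push_cast at htotal hfix ⊢
  linear_combination (-(r + 1) * s : ℤ) * htotal + (r - s : ℤ) * hfix
end
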